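/- There exists a constant c > 0 such that for every integer t ≥ 1, every prime power q ≥ 2, and every integer ŝ ≥ q, there exists a finite sequence over an alphabet of q^t symbols, with no two consecutive entries equal, of length at least c · q^(2t) · ŝ, which avoids alternations of length (t−1)! · (ŝ + 4q + 1) + 2. -/

import Mathlib

/-- The alternating sequence `a, b, a, b, ...` of length `k`. -/
def altSeq {α : Type*} (a b : α) : ℕ → List α
  | 0 => []
  | k + 1 => a :: altSeq b a k

/-- `l` avoids alternations of length `k`: it has no (not necessarily contiguous)
subsequence `a, b, a, b, ...` of length `k` with `a ≠ b`. -/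
def AvoidsAlt {α : Type*} (l : List α) (k : ℕ) : Prop :=
  ∀ a b : α, a ≠ b → ¬ (altSeq a b k).Sublist l

open Polynomial

section Alternations

variable {α β ι : Type*}

theorem length_altSeq (a b : α) (k : ℕ) : (altSeq a b k).length = k := by
  induction k generalizing a b with
  | zero => rfl
  | succ k ih => simp [altSeq, ih]

theorem map_altSeq (g : α → β) (a b : α) (k : ℕ) :
    (altSeq a b k).map g = altSeq (g a) (g b) k := by
  induction k generalizing a b with
  | zero => rfl
  | succ k ih => simp [altSeq, ih]

theorem mem_altSeq {a b x : α} {k : ℕ} (h : x ∈ altSeq a b k) : x = a ∨ x = b := by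
  induction k generalizing a b with
  | zero => simp [altSeq] at h
  | succ k ih =>
    rcases List.mem_cons.1 h with h | h
    · exact Or.inl h
    · exact (ih h).symm

theorem isChain_altSeq {a b : α} (hab : a ≠ b) (k : ℕ) : (altSeq a b k).IsChain (· ≠ ·) := by
  induction k generalizing a b with
  | zero => exact List.isChain_nil
  | succ k ih =>
    cases k with
    | zero => exact List.isChain_singleton a
    | succ k => exact List.isChain_cons_cons.2 ⟨hab, ih hab.symm⟩

theorem getLast?_altSeq_even (a b : α) (k : ℕ) :
    (altSeq a b (2 * k + 2)).getLast? = some b := by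
  induction k with
  | zero => rfl
  | succ k ih =>
    have h : altSeq a b (2 * (k + 1) + 2) = [a, b] ++ altSeq a b (2 * k + 2) := rfl
    rw [h, List.getLast?_append, ih]
    rfl

theorem eq_altSeq_of_append_eq {a b : α} {k : ℕ} {s u : List α} (h : altSeq a b k = s ++ u) :
    ∃ i j, k = i + j ∧ s = altSeq a b i ∧ (u = altSeq a b j ∨ u = altSeq b a j) := by
  induction s generalizing a b k with
  | nil => exact ⟨0, k, by simp, rfl, Or.inl h.symm⟩
  | cons x s ih =>
    cases k with
    | zero => simp [altSeq] at h
    | succ k =>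
      rw [altSeq, List.cons_append, List.cons.injEq] at h
      obtain ⟨i, j, hk, hs, hu⟩ := ih h.2
      exact ⟨i + 1, j, by omega, by rw [altSeq, hs, h.1], hu.symm⟩

/-- All alternations of `a` and `b` in `l`, starting with either symbol, have length at most `n`. -/
def AltLE (a b : α) (l : List α) (n : ℕ) : Prop :=
  ∀ k, (altSeq a b k).Sublist l ∨ (altSeq b a k).Sublist l → k ≤ n

theorem AltLE.symm {a b : α} {l : List α} {n : ℕ} (h : AltLE a b l n) : AltLE b a l n :=
  fun k hk => h k hk.symm

theorem AltLE.mono {a b : α} {l : List α} {m n : ℕ} (h : AltLE a b l m) (hmn : m ≤ n) :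
    AltLE a b l n :=
  fun k hk => (h k hk).trans hmn

theorem altLE_length (a b : α) (l : List α) : AltLE a b l l.length := by
  rintro k (h | h)
  · simpa [length_altSeq] using h.length_le
  · simpa [length_altSeq] using h.length_le

theorem altLE_one_of_notMem {a b : α} {l : List α} (h : a ∉ l) : AltLE a b l 1 := by
  rintro k (hk | hk)
  · match k with
    | 0 => omega
    | 1 => omega
    | k + 2 => exact absurd (hk.subset (by simp [altSeq])) h
  · match k with
    | 0 => omega
    | 1 => omega
    | k + 2 => exact absurd (hk.subset (by simp [altSeq])) h

theorem altLE_zero_of_notMem {a b : α} {l : List α} (ha : a ∉ l) (hb : b ∉ l) :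
    AltLE a b l 0 := by
  rintro k (hk | hk)
  · match k with
    | 0 => omega
    | k + 1 => exact absurd (hk.subset (by simp [altSeq])) ha
  · match k with
    | 0 => omega
    | k + 1 => exact absurd (hk.subset (by simp [altSeq])) hb

theorem AltLE.append {a b : α} {l₁ l₂ : List α} {m n : ℕ} (h₁ : AltLE a b l₁ m)
    (h₂ : AltLE a b l₂ n) : AltLE a b (l₁ ++ l₂) (m + n) := by
  have key : ∀ {a b : α}, AltLE a b l₁ m → AltLE a b l₂ n → ∀ k,
      (altSeq a b k).Sublist (l₁ ++ l₂) → k ≤ m + n := by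
    intro a b h₁ h₂ k hk
    obtain ⟨s, u, hsu, hs, hu⟩ := List.sublist_append_iff.1 hk
    obtain ⟨i, j, rfl, rfl, hj⟩ := eq_altSeq_of_append_eq hsu
    refine Nat.add_le_add (h₁ i (Or.inl hs)) (h₂ j ?_)
    rcases hj with rfl | rfl
    · exact Or.inl hu
    · exact Or.inr hu
  rintro k (hk | hk)
  · exact key h₁ h₂ k hk
  · exact key h₁.symm h₂.symm k hk

theorem AltLE.flatMap {a b : α} {g : ι → List α} {f : ι → ℕ} (L : List ι)
    (h : ∀ i ∈ L, AltLE a b (g i) (f i)) : AltLE a b (L.flatMap g) (L.map f).sum := by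
  induction L with
  | nil => exact altLE_zero_of_notMem (by simp) (by simp)
  | cons i L ih =>
    simp only [List.flatMap_cons, List.map_cons, List.sum_cons]
    exact (h i (by simp)).append (ih fun j hj => h j (by simp [hj]))

theorem AltLE.map {a b : α} {l : List α} {n : ℕ} (h : AltLE a b l n) {g : α → β}
    (hg : Function.Injective g) : AltLE (g a) (g b) (l.map g) n := by
  intro k hk
  rw [← map_altSeq, ← map_altSeq] at hk
  refine h k (hk.imp (fun hs => ?_) fun hs => ?_) <;>
  · obtain ⟨l', hl', he⟩ := List.sublist_map_iff.1 hs
    rwa [hg.list_map he]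

theorem isChain_flatMap {R : α → α → Prop} {g : ι → List α} (L : List ι)
    (hne : ∀ i ∈ L, g i ≠ []) (hc : ∀ i ∈ L, (g i).IsChain R)
    (hj : ∀ i ∈ L, ∀ j ∈ L, ∀ x ∈ (g i).getLast?, ∀ y ∈ (g j).head?, R x y) :
    (L.flatMap g).IsChain R := by
  induction L with
  | nil => exact List.isChain_nil
  | cons i L ih =>
    rw [List.flatMap_cons, List.isChain_append]
    refine ⟨hc i (by simp), ih (fun j h => hne j (by simp [h])) (fun j h => hc j (by simp [h]))
      (fun j h j' h' => hj j (by simp [h]) j' (by simp [h'])), ?_⟩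
    intro x hx y hy
    cases L with
    | nil => simp at hy
    | cons j L =>
      refine hj i (by simp) j (by simp) x hx y ?_
      rwa [List.flatMap_cons, List.head?_append_of_ne_nil _ (hne j (by simp))] at hy

end Alternations

section PairSequence

variable {α : Type*}

/-- The concatenation, over all pairs `z, j` of entries of a list, of `z, j, z, j, ...`
of length `2 * k + 2`. -/
def pairSeq (k : ℕ) : List α → List α
  | [] => []
  | z :: w => pairSeq k w ++ w.flatMap fun j => altSeq z j (2 * k + 2)

theorem mem_of_mem_pairSeq {k : ℕ} {v : List α} {x : α} (h : x ∈ pairSeq k v) : x ∈ v := by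
  induction v with
  | nil => simp [pairSeq] at h
  | cons z w ih =>
    rw [pairSeq, List.mem_append, List.mem_flatMap] at h
    rcases h with h | ⟨j, hj, h⟩
    · exact List.mem_cons_of_mem _ (ih h)
    · rcases mem_altSeq h with rfl | rfl <;> simp [hj]

theorem length_pairSeq (k : ℕ) (v : List α) :
    (pairSeq k v).length = v.length * (v.length - 1) * (k + 1) := by
  induction v with
  | nil => simp [pairSeq]
  | cons z w ih =>
    simp only [pairSeq, List.length_append, ih, List.length_flatMap, length_altSeq,
      List.map_const', List.sum_replicate, List.length_cons, smul_eq_mul]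
    cases w.length with
    | zero => simp
    | succ n => simp only [Nat.add_sub_cancel]; ring

theorem isChain_pairSeq (k : ℕ) {v : List α} (hv : v.Nodup) :
    (pairSeq k v).IsChain (· ≠ ·) := by
  induction v with
  | nil => exact List.isChain_nil
  | cons z w ih =>
    obtain ⟨hz, hw⟩ := List.nodup_cons.1 hv
    rw [pairSeq, List.isChain_append]
    refine ⟨ih hw, isChain_flatMap w (fun j _ => by simp [altSeq]) (fun j hj => ?_) ?_, ?_⟩
    · exact isChain_altSeq (ne_of_mem_of_not_mem hj hz).symm _
    · intro i hi j _ x hx y hy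
      rw [getLast?_altSeq_even, Option.mem_some_iff] at hx
      simp only [altSeq, List.head?_cons, Option.mem_some_iff] at hy
      subst hx hy
      exact fun h => hz (h ▸ hi)
    · intro x hx y hy hxy
      have hxw := mem_of_mem_pairSeq (List.mem_of_mem_getLast? hx)
      cases w with
      | nil => simp at hxw
      | cons j w =>
        simp only [List.flatMap_cons, altSeq, List.cons_append, List.head?_cons,
          Option.mem_some_iff] at hy
        exact hz (by rw [hy, ← hxy]; exact hxw)

theorem exists_head_ne_getLast_pairSeq (k : ℕ) {v : List α} (hv : v.Nodup) (h2 : 2 ≤ v.length) :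
    ∃ x y, (pairSeq k v).head? = some x ∧ (pairSeq k v).getLast? = some y ∧
      v.getLast? = some y ∧ x ≠ y := by
  induction v with
  | nil => simp at h2
  | cons z w ih =>
    obtain ⟨hz, hw⟩ := List.nodup_cons.1 hv
    rcases List.eq_nil_or_concat' w with rfl | ⟨w', y, rfl⟩
    · simp at h2
    have hlast : (pairSeq k (z :: (w' ++ [y]))).getLast? = some y := by
      rw [pairSeq, List.flatMap_append, List.flatMap_singleton, List.getLast?_append,
        List.getLast?_append, getLast?_altSeq_even]
      rfl
    have hlast' : (z :: (w' ++ [y])).getLast? = some y := by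
      rw [← List.cons_append, List.getLast?_append]
      rfl
    rcases w' with _ | ⟨c, w'⟩
    · refine ⟨z, y, rfl, hlast, hlast', ?_⟩
      rintro rfl
      simp at hz
    · obtain ⟨x, y', hx, -, hy', hne⟩ := ih hw (by simp)
      have : y' = y := by
        rw [List.getLast?_append] at hy'
        simpa using hy'.symm
      subst this
      refine ⟨x, y', ?_, hlast, hlast', hne⟩
      rw [pairSeq, List.head?_append, hx]
      rfl

theorem altLE_pairSeq (k : ℕ) {v : List α} (hv : v.Nodup) (h2 : 2 ≤ v.length) {a b : α}
    (hab : a ≠ b) : AltLE a b (pairSeq k v) (2 * k + 2 * v.length - 1) := by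
  classical
  induction v generalizing a b with
  | nil => simp at h2
  | cons z w ih =>
    by_cases ha : a ∈ z :: w
    swap
    · exact (altLE_one_of_notMem fun h => ha (mem_of_mem_pairSeq h)).mono (by omega)
    by_cases hb : b ∈ z :: w
    swap
    · exact (altLE_one_of_notMem fun h => hb (mem_of_mem_pairSeq h)).symm.mono (by omega)
    obtain ⟨hz, hw⟩ := List.nodup_cons.1 hv
    have hgroup : ∀ (u : List α) (x : α), x ≠ z → x ∉ u →
        x ∉ u.flatMap fun j => altSeq z j (2 * k + 2) := by
      intro u x hxz hxu hx
      obtain ⟨j, hj, hx⟩ := List.mem_flatMap.1 hx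
      rcases mem_altSeq hx with rfl | rfl
      · exact hxz rfl
      · exact hxu hj
    have hfirst : ∀ a ∈ w, AltLE a z (pairSeq k (z :: w)) (2 * k + 2 * (z :: w).length - 1) := by
      intro a ha
      have haz : a ≠ z := fun h => hz (h ▸ ha)
      by_cases hlen : w.length = 1
      · obtain ⟨c, rfl⟩ := List.length_eq_one_iff.1 hlen
        refine (altLE_length _ _ _).mono ?_
        rw [length_pairSeq]
        simp only [List.length_cons, List.length_nil]
        omega
      · obtain ⟨w₁, w₂, rfl⟩ := List.append_of_mem ha
        have hnd := List.nodup_append.1 hw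
        have h₁ : a ∉ w₁ := fun h => hnd.2.2 a h a (by simp) rfl
        have h₂ : a ∉ w₂ := (List.nodup_cons.1 hnd.2.1).1
        rw [pairSeq, List.flatMap_append, List.flatMap_cons]
        have hB : AltLE a z (pairSeq k (w₁ ++ a :: w₂)) 1 :=
          (altLE_one_of_notMem fun h => hz (mem_of_mem_pairSeq h)).symm
        have hmid := altLE_length a z (altSeq z a (2 * k + 2))
        rw [length_altSeq] at hmid
        refine (hB.append ((altLE_one_of_notMem (hgroup w₁ a haz h₁)).append
          (hmid.append (altLE_one_of_notMem (hgroup w₂ a haz h₂))))).mono ?_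
        simp only [List.length_cons, List.length_append] at hlen ⊢
        omega
    by_cases haz : a = z
    · subst haz
      exact (hfirst b ((List.mem_cons.1 hb).resolve_left hab.symm)).symm
    replace ha := (List.mem_cons.1 ha).resolve_left haz
    by_cases hbz : b = z
    · subst hbz
      exact hfirst a ha
    replace hb := (List.mem_cons.1 hb).resolve_left hbz
    have hlen : 2 ≤ w.length := by
      have : ({a, b} : Finset α).card ≤ w.toFinset.card :=
        Finset.card_le_card (by intro x; simp; rintro (rfl | rfl) <;> assumption)
      rw [Finset.card_pair hab, List.toFinset_card_of_nodup hw] at this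
      exact this
    have hG : AltLE a b (w.flatMap fun j => altSeq z j (2 * k + 2))
        (w.map fun j => (if j = a then 1 else 0) + if j = b then 1 else 0).sum := by
      refine AltLE.flatMap w fun j _ => ?_
      have hnot : ∀ x, x ≠ z → x ≠ j → x ∉ altSeq z j (2 * k + 2) := fun x hxz hxj hx =>
        (mem_altSeq hx).elim hxz hxj
      by_cases hja : j = a
      · exact (altLE_one_of_notMem (hnot b hbz (by rw [hja]; exact hab.symm))).symm.mono
          (by simp [hja])
      by_cases hjb : j = b
      · exact (altLE_one_of_notMem (hnot a haz (Ne.symm hja))).mono (by simp [hjb])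
      · exact (altLE_zero_of_notMem (hnot a haz (Ne.symm hja)) (hnot b hbz (Ne.symm hjb))).mono
          (Nat.zero_le _)
    have hsum : (w.map fun j => (if j = a then 1 else 0) + if j = b then 1 else 0).sum ≤ 2 := by
      rw [List.sum_map_add, ← List.sum_toFinset _ hw, ← List.sum_toFinset _ hw]
      simp [ha, hb]
    rw [pairSeq]
    refine ((ih hw hlen hab).append (hG.mono hsum)).mono ?_
    simp only [List.length_cons]
    omega

end PairSequence

section Polynomials

variable {F : Type*} [Field F]

theorem injective_X_sub_C_mul_add_C (x y : F) :
    Function.Injective fun c : F[X] => (X - C x) * c + C y := by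
  intro c d h
  exact mul_left_cancel₀ (X_sub_C_ne_zero x) (add_right_cancel h)

theorem exists_eq_X_sub_C_mul_add_C {p : F[X]} {x y : F} (h : p.eval x = y) :
    ∃ c, (X - C x) * c + C y = p := by
  obtain ⟨c, hc⟩ := X_sub_C_dvd_sub_C_eval (a := x) (p := p)
  exact ⟨c, by rw [← hc, h, sub_add_cancel]⟩

theorem coeff_X_sub_C_mul_add_C {c : F[X]} {n : ℕ} (hc : c ∈ degreeLT F (n + 1)) (x y : F) :
    ((X - C x) * c + C y).coeff (n + 1) = c.coeff n := by
  have h : c.coeff (n + 1) = 0 := coeff_eq_zero_of_degree_lt (mem_degreeLT.1 hc)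
  simp [sub_mul, coeff_X_mul, coeff_C_mul, h]

theorem card_filter_eval_eq_le [Fintype F] [DecidableEq F] {p r : F[X]} {n : ℕ} (hp : p ∈ degreeLT F (n + 1))
    (hr : r ∈ degreeLT F (n + 1)) (hne : p ≠ r) :
    (Finset.univ.filter fun x => p.eval x = r.eval x).card ≤ n := by
  have h0 : p - r ≠ 0 := sub_ne_zero.2 hne
  have hdeg : (p - r).natDegree < n + 1 :=
    (natDegree_lt_iff_degree_lt h0).2 (mem_degreeLT.1 (Submodule.sub_mem _ hp hr))
  refine le_trans (Finset.card_le_card ?_) <| (Multiset.toFinset_card_le _).trans <|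
    (card_roots' (p - r)).trans (Nat.lt_succ_iff.1 hdeg)
  intro x hx
  simpa [h0, sub_eq_zero] using hx

variable [Fintype F]

/-- Iterating the substitution which replaces a sequence of polynomials by the concatenation, over
all points `(x, y)` of the plane, of its images under `c ↦ (X - x) * c + y`. -/
noncomputable def planeSeq (l : List F[X]) : ℕ → List F[X]
  | 0 => l
  | n + 1 => (Finset.univ : Finset (F × F)).toList.flatMap fun z =>
      (planeSeq l n).map fun c => (X - C z.1) * c + C z.2

theorem length_planeSeq (l : List F[X]) (n : ℕ) :
    (planeSeq l n).length = Fintype.card F ^ (2 * n) * l.length := by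
  induction n with
  | zero => simp [planeSeq]
  | succ n ih =>
    simp only [planeSeq, List.length_flatMap, List.length_map, ih, List.map_const',
      List.sum_replicate, Finset.length_toList, Finset.card_univ, Fintype.card_prod, smul_eq_mul]
    ring

theorem mem_degreeLT_of_mem_planeSeq {l : List F[X]} (hl : ∀ p ∈ l, p ∈ degreeLT F 1) {n : ℕ}
    {p : F[X]} (hp : p ∈ planeSeq l n) : p ∈ degreeLT F (n + 1) := by
  induction n generalizing p with
  | zero => exact hl p hp
  | succ n ih =>
    obtain ⟨z, -, hp⟩ := List.mem_flatMap.1 hp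
    obtain ⟨c, hc, rfl⟩ := List.mem_map.1 hp
    refine Submodule.add_mem _ ?_ ?_
    · have h := mem_degreeLT.1 (ih hc)
      rw [mem_degreeLT, degree_mul, degree_X_sub_C, add_comm]
      by_cases h0 : c = 0
      · simp [h0]
      rw [degree_eq_natDegree h0] at h ⊢
      norm_cast at h ⊢
      omega
    · rw [mem_degreeLT]
      exact degree_C_le.trans_lt (by norm_cast; omega)

theorem coeff_head?_planeSeq {l : List F[X]} (hl : ∀ p ∈ l, p ∈ degreeLT F 1) {u : F}
    (hu : ∀ p ∈ l.head?, p.coeff 0 = u) {n : ℕ} : ∀ p ∈ (planeSeq l n).head?, p.coeff n = u := by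
  induction n with
  | zero => exact hu
  | succ n ih =>
    intro p hp
    rw [planeSeq, List.head?_flatMap] at hp
    obtain ⟨z, -, hp⟩ := List.exists_of_findSome?_eq_some hp
    rw [List.head?_map, Option.map_eq_some_iff] at hp
    obtain ⟨c, hc, rfl⟩ := hp
    rw [coeff_X_sub_C_mul_add_C (mem_degreeLT_of_mem_planeSeq hl (List.mem_of_mem_head? hc))]
    exact ih c hc

theorem coeff_getLast?_planeSeq {l : List F[X]} (hl : ∀ p ∈ l, p ∈ degreeLT F 1) {u : F}
    (hu : ∀ p ∈ l.getLast?, p.coeff 0 = u) {n : ℕ} :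
    ∀ p ∈ (planeSeq l n).getLast?, p.coeff n = u := by
  induction n with
  | zero => exact hu
  | succ n ih =>
    intro p hp
    rw [planeSeq, List.getLast?_flatMap] at hp
    obtain ⟨z, -, hp⟩ := List.exists_of_findSome?_eq_some hp
    rw [List.getLast?_map, Option.map_eq_some_iff] at hp
    obtain ⟨c, hc, rfl⟩ := hp
    rw [coeff_X_sub_C_mul_add_C (mem_degreeLT_of_mem_planeSeq hl (List.mem_of_mem_getLast? hc))]
    exact ih c hc

theorem isChain_planeSeq {l : List F[X]} (hl : ∀ p ∈ l, p ∈ degreeLT F 1) (hl0 : l ≠ [])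
    (hc : l.IsChain (· ≠ ·)) {u v : F} (hu : ∀ p ∈ l.head?, p.coeff 0 = u)
    (hv : ∀ p ∈ l.getLast?, p.coeff 0 = v) (huv : u ≠ v) (n : ℕ) :
    (planeSeq l n).IsChain (· ≠ ·) := by
  induction n with
  | zero => exact hc
  | succ n ih =>
    refine isChain_flatMap _ (fun z _ => ?_) (fun z _ => ?_) ?_
    · rw [← List.length_pos_iff, List.length_map, length_planeSeq]
      exact Nat.mul_pos (pow_pos Fintype.card_pos _) (List.length_pos_iff.2 hl0)
    · rw [List.isChain_map]
      exact ih.imp fun _ _ h => (injective_X_sub_C_mul_add_C z.1 z.2).ne h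
    · intro z _ z' _ p hp r hr hpr
      rw [List.getLast?_map, Option.mem_def, Option.map_eq_some_iff] at hp
      rw [List.head?_map, Option.mem_def, Option.map_eq_some_iff] at hr
      obtain ⟨c, hc, rfl⟩ := hp
      obtain ⟨d, hd, rfl⟩ := hr
      have h := congrArg (fun p => p.coeff (n + 1)) hpr
      beta_reduce at h
      rw [coeff_X_sub_C_mul_add_C (mem_degreeLT_of_mem_planeSeq hl (List.mem_of_mem_getLast? hc)),
        coeff_X_sub_C_mul_add_C (mem_degreeLT_of_mem_planeSeq hl (List.mem_of_mem_head? hd)),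
        coeff_head?_planeSeq hl hu d hd, coeff_getLast?_planeSeq hl hv c hc] at h
      exact huv h.symm

/-- The bound on the alternations of `planeSeq l n` over a field with `q` elements, where `A` is a
bound for `l`. -/
def altBound (A q : ℕ) : ℕ → ℕ
  | 0 => A
  | n + 1 => (n + 1) * altBound A q n + 2 * q

theorem altLE_planeSeq {l : List F[X]} (hl : ∀ p ∈ l, p ∈ degreeLT F 1) {A : ℕ}
    (hA : ∀ p r, p ≠ r → AltLE p r l A) (n : ℕ) {p r : F[X]} (hne : p ≠ r) :
    AltLE p r (planeSeq l n) (altBound A (Fintype.card F) n) := by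
  classical
  induction n generalizing p r with
  | zero => exact hA p r hne
  | succ n ih =>
    have hpos : 1 ≤ altBound A (Fintype.card F) (n + 1) := by
      have : 0 < Fintype.card F := Fintype.card_pos
      simp only [altBound]
      omega
    by_cases hp : p ∈ planeSeq l (n + 1)
    swap
    · exact (altLE_one_of_notMem hp).mono hpos
    by_cases hr : r ∈ planeSeq l (n + 1)
    swap
    · exact (altLE_one_of_notMem hr).symm.mono hpos
    set B := altBound A (Fintype.card F) n
    let f : F × F → ℕ := fun z =>
      if p.eval z.1 = r.eval z.1 then if p.eval z.1 = z.2 then B else 0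
      else (if p.eval z.1 = z.2 then 1 else 0) + if r.eval z.1 = z.2 then 1 else 0
    have hnot : ∀ (z : F × F) (s : F[X]), s.eval z.1 ≠ z.2 →
        s ∉ (planeSeq l n).map fun c => (X - C z.1) * c + C z.2 := by
      rintro z s hs h
      obtain ⟨c, -, rfl⟩ := List.mem_map.1 h
      simp at hs
    have hblock : ∀ z : F × F,
        AltLE p r ((planeSeq l n).map fun c => (X - C z.1) * c + C z.2) (f z) := by
      intro z
      by_cases h1 : p.eval z.1 = z.2 <;> by_cases h2 : r.eval z.1 = z.2
      · obtain ⟨c, rfl⟩ := exists_eq_X_sub_C_mul_add_C h1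
        obtain ⟨d, rfl⟩ := exists_eq_X_sub_C_mul_add_C h2
        refine ((ih (p := c) (r := d) ?_).map (injective_X_sub_C_mul_add_C z.1 z.2)).mono ?_
        · rintro rfl
          exact hne rfl
        · simp [f, B]
      · refine (altLE_one_of_notMem (hnot z r h2)).symm.mono ?_
        have : p.eval z.1 ≠ r.eval z.1 := fun h => h2 (h ▸ h1)
        simp only [f, if_neg this, if_pos h1]
        omega
      · refine (altLE_one_of_notMem (hnot z p h1)).mono ?_
        have : p.eval z.1 ≠ r.eval z.1 := fun h => h1 (h ▸ h2)
        simp only [f, if_neg this, if_pos h2]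
        omega
      · exact (altLE_zero_of_notMem (hnot z p h1) (hnot z r h2)).mono (Nat.zero_le _)
    refine (AltLE.flatMap _ fun z _ => hblock z).mono ?_
    rw [Finset.sum_map_toList, Fintype.sum_prod_type]
    calc ∑ x : F, ∑ y : F, f (x, y)
        ≤ ∑ x : F, ((if p.eval x = r.eval x then B else 0) + 2) := by
          refine Finset.sum_le_sum fun x _ => ?_
          by_cases h : p.eval x = r.eval x
          · simp [f, h]
          · simp [f, h, Finset.sum_add_distrib]
      _ = (Finset.univ.filter fun x => p.eval x = r.eval x).card * B + 2 * Fintype.card F := by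
          rw [Finset.sum_add_distrib, ← Finset.sum_filter]
          simp [mul_comm]
      _ ≤ (n + 1) * B + 2 * Fintype.card F := by
          gcongr
          exact card_filter_eval_eq_le (mem_degreeLT_of_mem_planeSeq hl hp)
            (mem_degreeLT_of_mem_planeSeq hl hr) hne

theorem altBound_le {A q s : ℕ} (hA : 2 * A ≤ 2 * s + q + 2) (n : ℕ) :
    altBound A q n ≤ n.factorial * (s + 4 * q + 1) + 1 := by
  have h2 : ∀ n, altBound A q (n + 2) + q ≤ (n + 2).factorial * (s + 4 * q + 1) := by
    intro n
    induction n with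
    | zero => simp [altBound, Nat.factorial]; omega
    | succ n ih =>
      rw [altBound, Nat.factorial_succ, mul_assoc]
      have := Nat.mul_le_mul_left (n + 2 + 1) ih
      nlinarith
  match n with
  | 0 => simp [altBound]; omega
  | 1 => simp [altBound]; omega
  | n + 2 => have := h2 n; omega

theorem exists_list_polynomial (n s : ℕ) (hF : 2 ≤ Fintype.card F) (hs : 2 ≤ s) :
    ∃ l : List F[X], (∀ p ∈ l, p ∈ degreeLT F (n + 1)) ∧ l.IsChain (· ≠ ·) ∧
      Fintype.card F ^ (2 * (n + 1)) * s ≤ 48 * l.length ∧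
      AvoidsAlt l (n.factorial * (s + 4 * Fintype.card F + 1) + 2) := by
  classical
  set q := Fintype.card F with hq
  obtain ⟨k, hk⟩ : ∃ k, s / 2 = k + 1 := ⟨s / 2 - 1, by omega⟩
  set m := q / 4 + 2 with hm
  let v : List F[X] := ((Finset.univ : Finset F).toList.take m).map C
  have hv : v.Nodup := ((Finset.nodup_toList _).sublist (List.take_sublist _ _)).map C_injective
  have hlen : v.length = m := by
    simp only [v, List.length_map, List.length_take, Finset.length_toList, Finset.card_univ]
    omega
  have h2 : 2 ≤ v.length := by omega
  have hC : ∀ p ∈ pairSeq k v, ∃ a, p = C a := by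
    intro p hp
    obtain ⟨a, -, rfl⟩ := List.mem_map.1 (mem_of_mem_pairSeq hp)
    exact ⟨a, rfl⟩
  have hdeg : ∀ p ∈ pairSeq k v, p ∈ degreeLT F 1 := by
    intro p hp
    obtain ⟨a, rfl⟩ := hC p hp
    rw [mem_degreeLT]
    exact degree_C_le.trans_lt (by norm_num)
  obtain ⟨x, y, hx, hy, -, hxy⟩ := exists_head_ne_getLast_pairSeq k hv h2
  obtain ⟨a, rfl⟩ := hC x (List.mem_of_mem_head? hx)
  obtain ⟨b, rfl⟩ := hC y (List.mem_of_mem_getLast? hy)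
  refine ⟨planeSeq (pairSeq k v) n, fun p hp => mem_degreeLT_of_mem_planeSeq hdeg hp, ?_, ?_, ?_⟩
  · refine isChain_planeSeq hdeg (fun h => by simp [h] at hx) (isChain_pairSeq k hv)
      (u := a) (v := b) ?_ ?_ (fun h => hxy (by rw [h])) n
    · simp [hx]
    · simp [hy]
  · rw [length_planeSeq, length_pairSeq, hlen, ← hq]
    have h4 : q * q * s ≤ (4 * m) * (4 * (m - 1)) * (3 * (k + 1)) := by
      gcongr <;> omega
    calc q ^ (2 * (n + 1)) * s = q ^ (2 * n) * (q * q * s) := by ring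
      _ ≤ q ^ (2 * n) * ((4 * m) * (4 * (m - 1)) * (3 * (k + 1))) := by gcongr
      _ = 48 * (q ^ (2 * n) * (m * (m - 1) * (k + 1))) := by ring
  · intro p r hpr hsub
    have h := altLE_planeSeq hdeg (fun p r h => altLE_pairSeq k hv h2 h) n hpr _ (Or.inl hsub)
    have := h.trans (altBound_le (q := q) (s := s) (by omega) n)
    omega

theorem exists_list_fin (n : ℕ) {q s : ℕ} (hF : Fintype.card F = q) (hq : 2 ≤ q) (hs : 2 ≤ s) :
    ∃ l : List (Fin (q ^ (n + 1))), l.IsChain (· ≠ ·) ∧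
      q ^ (2 * (n + 1)) * s ≤ 48 * l.length ∧
      AvoidsAlt l (n.factorial * (s + 4 * q + 1) + 2) := by
  classical
  subst hF
  obtain ⟨l, hdeg, hc, hlen, hav⟩ := exists_list_polynomial (F := F) n s hq hs
  lift l to List (degreeLT F (n + 1)) using hdeg
  let e : degreeLT F (n + 1) ≃ Fin (Fintype.card F ^ (n + 1)) :=
    (degreeLTEquiv F (n + 1)).toEquiv.trans (Fintype.equivFinOfCardEq (by simp))
  refine ⟨l.map e, ?_, by simpa using hlen, ?_⟩
  · rw [List.isChain_map] at hc ⊢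
    exact hc.imp fun _ _ h h' => h (congrArg _ (e.injective h'))
  · intro a b hab hsub
    refine hav (e.symm a) (e.symm b) (fun h => hab (e.symm.injective (Subtype.ext h))) ?_
    have := hsub.map fun i => ((e.symm i : degreeLT F (n + 1)) : F[X])
    rw [map_altSeq, List.map_map] at this
    simpa [Function.comp_def] using this

end Polynomials

theorem stmt8 :
    ∃ c : ℝ, 0 < c ∧ ∀ t q sh : ℕ, 1 ≤ t → IsPrimePow q → 2 ≤ q → q ≤ sh →
      ∃ l : List (Fin (q ^ t)), l.Chain' (· ≠ ·) ∧
        c * (q : ℝ) ^ (2 * t) * sh ≤ (l.length : ℝ) ∧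
        AvoidsAlt l ((t - 1).factorial * (sh + 4 * q + 1) + 2) := by
  refine ⟨1 / 48, by norm_num, ?_⟩
  intro t q sh ht hq h2 hsh
  obtain ⟨n, rfl⟩ : ∃ n, t = n + 1 := ⟨t - 1, by omega⟩
  have hcard : Fintype.card (ULift.{0} (Fin q)) = q := by simp
  obtain ⟨hfield⟩ := Fintype.nonempty_field_iff.2 (hcard.symm ▸ hq)
  obtain ⟨l, hc, hlen, hav⟩ := exists_list_fin n hcard h2 (h2.trans hsh)
  refine ⟨l, hc, ?_, hav⟩
  have : (q : ℝ) ^ (2 * (n + 1)) * sh ≤ 48 * l.length := by exact_mod_cast hlen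
  linarith
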